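/- With the notation below, 𝓕(0) is the constant function 1, and for every N ≥ 0 the identity 𝓕(𝓒^N) = 𝓒^{N+1} holds, where 𝓒^0 is the constant function 1. -/

import Mathlib

open MeasureTheory ENNReal
open scoped Classical

noncomputable section

/-- The children of vertex `i` in a tree on `{0,…,n}` rooted at `0`. -/
def childrenF {n : ℕ} (τ : SimpleGraph (Fin (n + 1))) (i : Fin (n + 1)) :
    Finset (Fin (n + 1)) :=
  Finset.univ.filter (fun j => τ.Adj i j ∧ τ.dist 0 j = τ.dist 0 i + 1)

/-- `C_n^N(x_0; x_1,…,x_n)`: sum over trees rooted at `0` of depth at most `N` of the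
product of the vertex weights `c`. -/
def treeCN {S : Type*} (c : (m : ℕ) → S → (Fin m → S) → ℝ≥0∞) (n N : ℕ)
    (x : Fin (n + 1) → S) : ℝ≥0∞ :=
  ∑ τ : SimpleGraph (Fin (n + 1)),
    if τ.IsTree ∧ ∀ i, τ.dist 0 i ≤ N then
      ∏ i : Fin (n + 1),
        c (childrenF τ i).card (x i)
          (fun k => x (((childrenF τ i).orderIsoOfFin rfl k : Fin (n + 1))))
    else 0

/-- The integrated tree sum `𝓒^N`. -/
def CInt {S : Type*} [MeasurableSpace S] (m : Measure S)
    (c : (k : ℕ) → S → (Fin k → S) → ℝ≥0∞) (N : ℕ) : S → ℝ≥0∞ :=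
  fun x => 1 + ∑' n : ℕ, (1 / ((n + 1).factorial : ℝ≥0∞)) *
    ∫⁻ y : Fin (n + 1) → S, treeCN c (n + 1) N (Fin.cons x y)
      ∂(Measure.pi fun _ : Fin (n + 1) => m)

/-- The tree-generating operator `𝓕`. -/
def FOp {S : Type*} [MeasurableSpace S] (m : Measure S)
    (c : (k : ℕ) → S → (Fin k → S) → ℝ≥0∞) (μ : S → ℝ≥0∞) : S → ℝ≥0∞ :=
  fun x => 1 + ∑' n : ℕ, (1 / ((n + 1).factorial : ℝ≥0∞)) *
    ∫⁻ y : Fin (n + 1) → S, c (n + 1) x y * ∏ i, μ (y i)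
      ∂(Measure.pi fun _ : Fin (n + 1) => m)

section RootedForests

variable {S : Type*}

/-- The weight `c`, with the last arguments indexed by an arbitrary finite type. -/
def finWeight (c : (k : ℕ) → S → (Fin k → S) → ℝ≥0∞) (T : Type) [Finite T]
    (x : S) (y : T → S) : ℝ≥0∞ :=
  c (Nat.card T) x (y ∘ (Finite.equivFin T).symm)

lemma finWeight_eq {c : (k : ℕ) → S → (Fin k → S) → ℝ≥0∞}
    (hsymm : ∀ (k : ℕ) (x : S) (y : Fin k → S) (σ : Equiv.Perm (Fin k)),
      c k x (y ∘ σ) = c k x y) {T : Type} [Finite T] {k : ℕ} (e : Fin k ≃ T)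
    (x : S) (y : T → S) : finWeight c T x y = c k x (y ∘ e) := by
  obtain rfl : k = Nat.card T := by rw [← Nat.card_congr e, Nat.card_fin]
  rw [finWeight, ← hsymm _ x _ (e.trans (Finite.equivFin T))]
  congr 1
  ext i
  simp

lemma finWeight_comp_equiv {c : (k : ℕ) → S → (Fin k → S) → ℝ≥0∞}
    (hsymm : ∀ (k : ℕ) (x : S) (y : Fin k → S) (σ : Equiv.Perm (Fin k)),
      c k x (y ∘ σ) = c k x y) {T T' : Type} [Finite T] [Finite T'] (e : T ≃ T')
    (x : S) (y : T' → S) : finWeight c T x (y ∘ e) = finWeight c T' x y := by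
  rw [finWeight, finWeight_eq hsymm ((Finite.equivFin T).symm.trans e)]
  rfl

lemma measurable_finWeight [MeasurableSpace S] {c : (k : ℕ) → S → (Fin k → S) → ℝ≥0∞}
    (hmeas : ∀ k : ℕ, Measurable fun p : S × (Fin k → S) => c k p.1 p.2)
    (T : Type) [Finite T] : Measurable fun p : S × (T → S) => finWeight c T p.1 p.2 := by
  refine (hmeas (Nat.card T)).comp (measurable_fst.prodMk ?_)
  exact measurable_pi_lambda _ fun i => (measurable_pi_apply _).comp measurable_snd

lemma tsum_factorial_sum_finset (J : ℕ → ℕ → ℝ≥0∞) :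
    ∑' n : ℕ, (1 / (n.factorial : ℝ≥0∞)) *
        ∑ A : Finset (Fin n), J A.card (n - A.card) =
      ∑' a : ℕ, (1 / (a.factorial : ℝ≥0∞)) *
        ∑' b : ℕ, (1 / (b.factorial : ℝ≥0∞)) * J a b := by
  have h : ∀ n : ℕ, (1 / (n.factorial : ℝ≥0∞)) *
        ∑ A : Finset (Fin n), J A.card (n - A.card) =
      ∑ p ∈ Finset.HasAntidiagonal.antidiagonal n, (1 / (p.1.factorial : ℝ≥0∞)) *
        ((1 / (p.2.factorial : ℝ≥0∞)) * J p.1 p.2) := by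
    intro n
    rw [← Finset.powerset_univ,
      Finset.sum_powerset_apply_card (fun k => J k (n - k)),
      Finset.Nat.sum_antidiagonal_eq_sum_range_succ_mk, Finset.card_univ, Fintype.card_fin,
      Finset.mul_sum]
    refine Finset.sum_congr rfl fun k hk => ?_
    have hk : k ≤ n := Nat.lt_succ_iff.mp (Finset.mem_range.mp hk)
    rw [nsmul_eq_mul, ← mul_assoc, ← mul_assoc]
    congr 1
    have hf : ∀ j : ℕ, (j.factorial : ℝ≥0∞) ≠ 0 := fun j => by
      exact_mod_cast j.factorial_ne_zero
    have ht : ∀ j : ℕ, (j.factorial : ℝ≥0∞) ≠ ⊤ := fun j => ENNReal.natCast_ne_top _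
    rw [← Nat.choose_mul_factorial_mul_factorial hk]
    push_cast
    have hc : (n.choose k : ℝ≥0∞) ≠ 0 := by exact_mod_cast (Nat.choose_pos hk).ne'
    have hct : (n.choose k : ℝ≥0∞) ≠ ⊤ := ENNReal.natCast_ne_top _
    simp only [one_div]
    rw [ENNReal.mul_inv (Or.inr (ht _)) (Or.inr (hf _)),
      ENNReal.mul_inv (Or.inl hc) (Or.inl hct)]
    calc _ = ((n.choose k : ℝ≥0∞) * (n.choose k : ℝ≥0∞)⁻¹) *
          ((k.factorial : ℝ≥0∞)⁻¹ * ((n - k).factorial : ℝ≥0∞)⁻¹) := by ring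
      _ = _ := by rw [ENNReal.mul_inv_cancel hc hct, one_mul]
  simp_rw [h, ← ENNReal.tsum_mul_left]
  rw [← ENNReal.tsum_prod (f := fun a b => (1 / (a.factorial : ℝ≥0∞)) *
    ((1 / (b.factorial : ℝ≥0∞)) * J a b)), ← Finset.HasAntidiagonal.sigmaAntidiagonalEquivProd.tsum_eq,
    ENNReal.tsum_sigma']
  refine tsum_congr fun n => ?_
  rw [tsum_fintype, ← Finset.sum_coe_sort]
  rfl

lemma lintegral_comp_equiv [MeasurableSpace S] (m : Measure S) [SigmaFinite m]
    {T T' : Type} [Fintype T] [Fintype T'] (e : T ≃ T') (f : (T → S) → ℝ≥0∞) :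
    ∫⁻ y : T' → S, f (y ∘ e) ∂(Measure.pi fun _ => m) =
      ∫⁻ y : T → S, f y ∂(Measure.pi fun _ => m) := by
  have := (measurePreserving_arrowCongr' (fun _ : T' => m) (fun _ : T => m) e.symm
    (MeasurableEquiv.refl S) fun _ => MeasurePreserving.id m)
  rw [← this.lintegral_comp_emb (MeasurableEquiv.measurableEmbedding _)]
  rfl

/-- Invariance of a weight on a pair of labelled finite sets under bijections of the labels. -/
def EquivInvariant (Q : ∀ (A B : Type) [Finite A] [Finite B], (A → S) → (B → S) → ℝ≥0∞) :
    Prop :=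
  ∀ (A A' B B' : Type) [Finite A] [Finite A'] [Finite B] [Finite B'] (e : A ≃ A')
    (f : B ≃ B') (y : A' → S) (z : B' → S), Q A B (y ∘ e) (z ∘ f) = Q A' B' y z

/-- Exponential formula for sums over splittings of a labelled set into two parts. -/
lemma tsum_lintegral_sum_finset [MeasurableSpace S] (m : Measure S) [SigmaFinite m]
    (Q : ∀ (A B : Type) [Finite A] [Finite B], (A → S) → (B → S) → ℝ≥0∞)
    (hQ : EquivInvariant Q)
    (hQm : ∀ (A B : Type) [Finite A] [Finite B],
      Measurable fun p : (A → S) × (B → S) => Q A B p.1 p.2) :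
    ∑' n : ℕ, (1 / (n.factorial : ℝ≥0∞)) * ∫⁻ y : Fin n → S,
        ∑ A : Finset (Fin n), Q {v // v ∈ A} {v // v ∉ A} (fun v => y v) (fun v => y v)
          ∂(Measure.pi fun _ => m) =
      ∑' a : ℕ, (1 / (a.factorial : ℝ≥0∞)) * ∫⁻ y : Fin a → S,
        ∑' b : ℕ, (1 / (b.factorial : ℝ≥0∞)) * ∫⁻ z : Fin b → S, Q (Fin a) (Fin b) y z
          ∂(Measure.pi fun _ => m) ∂(Measure.pi fun _ => m) := by
  have hm2 : ∀ (a b : ℕ), Measurable fun y : Fin a → S => ∫⁻ z : Fin b → S, Q (Fin a) (Fin b) y z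
      ∂(Measure.pi fun _ => m) := fun a b => (hQm _ _).lintegral_prod_right'
  have key : ∀ n (A : Finset (Fin n)), ∫⁻ y : Fin n → S,
      Q {v // v ∈ A} {v // v ∉ A} (fun v => y v) (fun v => y v) ∂(Measure.pi fun _ => m) =
      ∫⁻ y : Fin A.card → S, ∫⁻ z : Fin (n - A.card) → S, Q (Fin A.card) (Fin (n - A.card)) y z
          ∂(Measure.pi fun _ => m) ∂(Measure.pi fun _ => m) := by
    intro n A
    have hp := measurePreserving_piEquivPiSubtypeProd (fun _ : Fin n => m) (· ∈ A)
    have h1 := hp.lintegral_comp_emb (MeasurableEquiv.measurableEmbedding _)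
      (fun p => Q {v // v ∈ A} {v // v ∉ A} p.1 p.2)
    refine h1.trans ?_
    rw [lintegral_prod _ (hQm _ _).aemeasurable]
    have e : {v // v ∈ A} ≃ Fin A.card := Fintype.equivFinOfCardEq (by simp)
    have f : {v // v ∉ A} ≃ Fin (n - A.card) := Fintype.equivFinOfCardEq (by
      rw [Fintype.card_subtype_compl]; simp)
    rw [← @lintegral_comp_equiv _ _ m _ _ _ (_) (_) e.symm]
    refine lintegral_congr fun y => ?_
    rw [← @lintegral_comp_equiv _ _ m _ _ _ (_) (_) f.symm]
    exact lintegral_congr fun z => (hQ _ _ _ _ e.symm f.symm _ _).symm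
  have key2 : ∀ n, ∫⁻ y : Fin n → S,
        ∑ A : Finset (Fin n), Q {v // v ∈ A} {v // v ∉ A} (fun v => y v) (fun v => y v)
          ∂(Measure.pi fun _ => m) =
      ∑ A : Finset (Fin n), ∫⁻ y : Fin A.card → S, ∫⁻ z : Fin (n - A.card) → S,
        Q (Fin A.card) (Fin (n - A.card)) y z
          ∂(Measure.pi fun _ => m) ∂(Measure.pi fun _ => m) := by
    intro n
    rw [lintegral_finsetSum]
    · exact Finset.sum_congr rfl fun A _ => key n A
    · intro A _
      exact (hQm _ _).comp (Measurable.prodMk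
        (measurable_pi_lambda _ fun i => measurable_pi_apply _)
        (measurable_pi_lambda _ fun i => measurable_pi_apply _))
  simp_rw [key2]
  rw [tsum_factorial_sum_finset (fun a b => ∫⁻ y : Fin a → S, ∫⁻ z : Fin b → S,
        Q (Fin a) (Fin b) y z ∂(Measure.pi fun _ => m) ∂(Measure.pi fun _ => m))]
  refine tsum_congr fun a => ?_
  rw [lintegral_tsum fun b => ((hm2 a b).const_mul _).aemeasurable]
  congr 1
  refine tsum_congr fun b => ?_
  rw [lintegral_const_mul _ (hm2 a b)]

/-- Glue maps defined on a finset and on its complement. -/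
def glue {V X Y : Type} (A : Finset V) (g : {v // v ∈ A} → X) (q : {v // v ∉ A} → Y) (v : V) :
    X ⊕ Y :=
  if h : v ∈ A then Sum.inl (g ⟨v, h⟩) else Sum.inr (q ⟨v, h⟩)

lemma glue_mem {V X Y : Type} {A : Finset V} (g : {v // v ∈ A} → X) (q : {v // v ∉ A} → Y)
    (v : {v // v ∈ A}) : glue A g q v = Sum.inl (g v) := by simp [glue]

lemma glue_notMem {V X Y : Type} {A : Finset V} (g : {v // v ∈ A} → X) (q : {v // v ∉ A} → Y)
    (v : {v // v ∉ A}) : glue A g q v = Sum.inr (q v) := by simp [glue, v.2]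

lemma glue_bijective (V X Y : Type) [Finite V] : Function.Bijective
    fun s : (Σ A : Finset V, ({v // v ∈ A} → X) × ({v // v ∉ A} → Y)) => glue s.1 s.2.1 s.2.2 := by
  cases nonempty_fintype V
  constructor
  · rintro ⟨A, g, q⟩ ⟨A', g', q'⟩ h
    dsimp only at h
    have hA : A = A' := by
      ext v
      have := congrFun h v
      by_cases h1 : v ∈ A <;> by_cases h2 : v ∈ A' <;> simp_all [glue]
    subst hA
    congr 2
    · funext v
      simpa [glue_mem] using congrFun h v
    · funext v
      simpa [glue_notMem] using congrFun h v
  · intro p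
    have hr : ∀ v : {v // v ∉ Finset.univ.filter fun v => (p v).isLeft}, (p v).isRight := by
      rintro ⟨v, hv⟩
      simpa using hv
    refine ⟨⟨Finset.univ.filter fun v => (p v).isLeft,
      fun v => (p v).getLeft (Finset.mem_filter.mp v.2).2, fun v => (p v).getRight (hr v)⟩, ?_⟩
    funext v
    by_cases h : (p v).isLeft <;> simp [glue, h]

lemma tsum_eq_sum_glue {V X Y : Type} [Fintype V] [Finite X] [Finite Y]
    (F : (V → X ⊕ Y) → ℝ≥0∞) : ∑' p, F p = ∑ A : Finset V, ∑' g, ∑' q, F (glue A g q) := by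
  rw [← (Equiv.ofBijective _ (glue_bijective V X Y)).tsum_eq F, ENNReal.tsum_sigma', tsum_fintype]
  exact Finset.sum_congr rfl fun A _ => ENNReal.tsum_prod (f := fun g q => F (glue A g q))

def glueFiberLeft {V X Y : Type} {A : Finset V} (g : {v // v ∈ A} → X) (q : {v // v ∉ A} → Y)
    (a : X) : {v // g v = a} ≃ {v // glue A g q v = Sum.inl a} where
  toFun v := ⟨v.1, by rw [glue_mem, v.2]⟩
  invFun v := ⟨⟨v.1, by
    by_contra h
    have := v.2
    simp [glue, h] at this⟩, by
    have h2 := v.2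
    by_cases h : v.1 ∈ A <;> simp only [glue, h] at h2
    · simpa using h2
    · simp at h2⟩
  left_inv _ := rfl
  right_inv _ := rfl

def glueFiberRight {V X Y : Type} {A : Finset V} (g : {v // v ∈ A} → X) (q : {v // v ∉ A} → Y)
    (a : Y) : {v // q v = a} ≃ {v // glue A g q v = Sum.inr a} where
  toFun v := ⟨v.1, by rw [glue_notMem, v.2]⟩
  invFun v := ⟨⟨v.1, by
    intro h
    have := v.2
    simp [glue, h] at this⟩, by
    have h2 := v.2
    by_cases h : v.1 ∈ A <;> simp only [glue, h] at h2
    · simp at h2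
    · simpa using h2⟩
  left_inv _ := rfl
  right_inv _ := rfl

/-- Sum over all maps `g : V → R` of the product of weights of the fibres of `g`. -/
def fiberSum {R : Type} (F : R → ∀ (T : Type) [Finite T], (T → S) → ℝ≥0∞) (V : Type) [Finite V]
    (y : V → S) : ℝ≥0∞ :=
  ∑' g : V → R, ∏ᶠ r, F r {v // g v = r} fun v => y v

lemma fiberSum_comp_equiv {R : Type} {F : R → ∀ (T : Type) [Finite T], (T → S) → ℝ≥0∞}
    (hF : ∀ r (T T' : Type) [Finite T] [Finite T'] (e : T ≃ T') (y : T' → S),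
      F r T (y ∘ e) = F r T' y) {V V' : Type} [Finite V] [Finite V'] (e : V ≃ V') (y : V' → S) :
    fiberSum F V (y ∘ e) = fiberSum F V' y := by
  rw [fiberSum, fiberSum, ← (Equiv.arrowCongr e (Equiv.refl R)).tsum_eq]
  refine tsum_congr fun g => finprod_congr fun r => ?_
  refine Eq.trans ?_ (hF r _ _ (e.subtypeEquiv fun v => by simp : {v // g v = r} ≃
    {v // (Equiv.arrowCongr e (Equiv.refl R)) g v = r}) _)
  rfl

lemma measurable_finprod_ennreal {α ι : Type*} [MeasurableSpace α] [Finite ι] {f : ι → α → ℝ≥0∞}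
    (hf : ∀ i, Measurable (f i)) : Measurable fun a => ∏ᶠ i, f i a := by
  cases nonempty_fintype ι
  simp_rw [finprod_eq_prod_of_fintype]
  exact Finset.measurable_fun_prod _ fun i _ => hf i

lemma measurable_restrict [MeasurableSpace S] {V : Type} (P : V → Prop) :
    Measurable fun (y : V → S) (v : {v // P v}) => y v :=
  measurable_pi_lambda _ fun _ => measurable_pi_apply _

lemma measurable_fiberSum [MeasurableSpace S] {R : Type} [Finite R]
    {F : R → ∀ (T : Type) [Finite T], (T → S) → ℝ≥0∞}
    (hFm : ∀ r (T : Type) [Finite T], Measurable (F r T)) (V : Type) [Finite V] :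
    Measurable (fiberSum F V) :=
  Measurable.tsum fun _ => measurable_finprod_ennreal fun _ =>
    (hFm _ _).comp (measurable_restrict _)

lemma fiberSum_equiv {R R' : Type} (e : R ≃ R')
    {F : R' → ∀ (T : Type) [Finite T], (T → S) → ℝ≥0∞}
    (hF : ∀ r (T T' : Type) [Finite T] [Finite T'] (e : T ≃ T') (y : T' → S),
      F r T (y ∘ e) = F r T' y) (V : Type) [Finite V] (y : V → S) :
    fiberSum F V y = fiberSum (fun r => F (e r)) V y := by
  rw [fiberSum, fiberSum, ← (Equiv.arrowCongr (Equiv.refl V) e).tsum_eq]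
  refine tsum_congr fun g => ?_
  rw [← finprod_comp_equiv e]
  refine finprod_congr fun r => ?_
  refine (hF (e r) _ _ (Equiv.subtypeEquivRight fun v => by simp : {v // g v = r} ≃
    {v // (Equiv.arrowCongr (Equiv.refl V) e) g v = e r}) _).symm

lemma fiberSum_sum_unit {R : Type} [Finite R]
    {F : R ⊕ Unit → ∀ (T : Type) [Finite T], (T → S) → ℝ≥0∞}
    (hF : ∀ r (T T' : Type) [Finite T] [Finite T'] (e : T ≃ T') (y : T' → S),
      F r T (y ∘ e) = F r T' y) (V : Type) [Fintype V] (y : V → S) :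
    fiberSum F V y = ∑ A : Finset V, fiberSum (fun r => F (Sum.inl r)) {v // v ∈ A} (fun v => y v) *
      F (Sum.inr ()) {v // v ∉ A} (fun v => y v) := by
  cases nonempty_fintype R
  rw [fiberSum, tsum_eq_sum_glue]
  refine Finset.sum_congr rfl fun A _ => ?_
  rw [fiberSum, ← ENNReal.tsum_mul_right]
  refine tsum_congr fun g => ?_
  rw [tsum_eq_single default (fun q hq => absurd (Subsingleton.elim _ _) hq),
    finprod_eq_prod_of_fintype, finprod_eq_prod_of_fintype, Fintype.prod_sum_type]
  congr 1
  · exact Finset.prod_congr rfl fun r _ => (hF _ _ _ (glueFiberLeft g default r) _).symm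
  · rw [Fintype.prod_unique]
    refine (hF _ _ _ (((Equiv.subtypeUnivEquiv (fun v => rfl) :
      {v : {v // v ∉ A} // (default : {v // v ∉ A} → Unit) v = default} ≃ _)).symm.trans
        (glueFiberRight g default default)) _).symm

lemma tsum_lintegral_fiberSum [MeasurableSpace S] (m : Measure S) [SigmaFinite m]
    (R : Type) [Finite R] : ∀ (F : R → ∀ (T : Type) [Finite T], (T → S) → ℝ≥0∞)
    (_ : ∀ r (T T' : Type) [Finite T] [Finite T'] (e : T ≃ T') (y : T' → S),
      F r T (y ∘ e) = F r T' y)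
    (_ : ∀ r (T : Type) [Finite T], Measurable (F r T)),
    ∑' n : ℕ, (1 / (n.factorial : ℝ≥0∞)) *
        ∫⁻ y : Fin n → S, fiberSum F (Fin n) y ∂(Measure.pi fun _ => m) =
      ∏ᶠ r, ∑' n : ℕ, (1 / (n.factorial : ℝ≥0∞)) *
        ∫⁻ y : Fin n → S, F r (Fin n) y ∂(Measure.pi fun _ => m) := by
  induction R using Finite.induction_empty_option with
  | of_equiv e ih =>
    intro F hF hFm
    simp_rw [fiberSum_equiv e hF]
    rw [ih (fun r => F (e r)) (fun r => hF (e r)) (fun r => hFm (e r)), ← finprod_comp_equiv e]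
  | h_empty =>
    intro F hF hFm
    rw [finprod_of_isEmpty, tsum_eq_single 0]
    · simp [fiberSum, tsum_fintype, finprod_of_isEmpty]
    · intro n hn
      have : Nonempty (Fin n) := ⟨⟨0, Nat.pos_of_ne_zero hn⟩⟩
      simp [fiberSum]
  | @h_option R _ ih =>
    intro F hF hFm
    have e := (Equiv.optionEquivSumPUnit.{0} R).symm
    simp_rw [fiberSum_equiv e hF]
    rw [← finprod_comp_equiv e]
    generalize hG : (fun r => F (e r)) = G
    have hG' : ∀ r, F (e r) = G r := fun r => congrFun hG r
    simp_rw [hG']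
    have hGi : ∀ r (T T' : Type) [Finite T] [Finite T'] (e : T ≃ T') (y : T' → S),
      G r T (y ∘ e) = G r T' y := fun r => hG' r ▸ hF (e r)
    have hGm : ∀ r (T : Type) [Finite T], Measurable (G r T) := fun r => hG' r ▸ hFm (e r)
    simp_rw [fiberSum_sum_unit hGi]
    rw [tsum_lintegral_sum_finset m (fun A B _ _ y z => fiberSum (fun r => G (Sum.inl r)) A y *
      G (Sum.inr ()) B z)]
    · rw [finprod_eq_prod_of_fintype, Fintype.prod_sum_type, Fintype.prod_unique (ι := PUnit),
        ← finprod_eq_prod_of_fintype, ← ih _ (fun r => hGi _) (fun r => hGm _),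
        ← ENNReal.tsum_mul_right]
      refine tsum_congr fun a => ?_
      rw [mul_assoc, ← lintegral_mul_const _ (measurable_fiberSum (fun r => hGm _) _)]
      congr 1
      refine lintegral_congr fun y => ?_
      rw [← ENNReal.tsum_mul_left]
      refine tsum_congr fun b => ?_
      rw [lintegral_const_mul _ (hGm _ _), mul_left_comm]
    · intro A A' B B' _ _ _ _ e f y z
      dsimp only
      rw [fiberSum_comp_equiv (fun r => hGi _), hGi]
    · intro A B _ _
      exact ((measurable_fiberSum (fun r => hGm _) _).comp measurable_fst).mul
        ((hGm _ _).comp measurable_snd)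

/-- One step towards the roots in the forest with parent map `p`; the roots stay fixed. -/
def forestStep {R V : Type} (p : V → R ⊕ V) : R ⊕ V → R ⊕ V := Sum.elim Sum.inl p

/-- Every vertex of the forest with parent map `p` has depth at most `N`. -/
def DepthLE {R V : Type} (N : ℕ) (p : V → R ⊕ V) : Prop :=
  ∀ v, ((forestStep p)^[N] (Sum.inr v)).isLeft

/-- The weight of a forest given by its parent map. -/
def forestWeight (c : (k : ℕ) → S → (Fin k → S) → ℝ≥0∞) {R V : Type} [Finite V] (x : R → S)
    (y : V → S) (p : V → R ⊕ V) : ℝ≥0∞ :=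
  ∏ᶠ w : R ⊕ V, finWeight c {v // p v = w} (Sum.elim x y w) fun v => y v

/-- Sum of the weights of all forests of depth at most `N` with roots `R` and other vertices `V`. -/
def forestSum (c : (k : ℕ) → S → (Fin k → S) → ℝ≥0∞) (N : ℕ) (R V : Type) [Finite V]
    (x : R → S) (y : V → S) : ℝ≥0∞ :=
  ∑' p : V → R ⊕ V, if DepthLE N p then forestWeight c x y p else 0

lemma forestStep_iterate_inl {R V : Type} (p : V → R ⊕ V) (k : ℕ) (r : R) :
    (forestStep p)^[k] (Sum.inl r) = Sum.inl r :=
  Function.iterate_fixed rfl k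

lemma depthLE_congr {R R' V V' : Type} (N : ℕ) (e : R ≃ R') (f : V ≃ V') (p : V → R ⊕ V) :
    DepthLE N (Equiv.arrowCongr f (e.sumCongr f) p) ↔ DepthLE N p := by
  have h : Function.Semiconj (e.sumCongr f) (forestStep p)
      (forestStep (Equiv.arrowCongr f (e.sumCongr f) p)) := by
    rintro (r | v) <;> simp [forestStep]
  refine (f.forall_congr fun v => ?_).symm
  have := (h.iterate_right N) (Sum.inr v)
  simp only [Equiv.sumCongr_apply, Sum.map_inr] at this
  rw [← this, Sum.isLeft_map]

lemma forestSum_equivInvariant {c : (k : ℕ) → S → (Fin k → S) → ℝ≥0∞}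
    (hsymm : ∀ (k : ℕ) (x : S) (y : Fin k → S) (σ : Equiv.Perm (Fin k)),
      c k x (y ∘ σ) = c k x y) (N : ℕ) :
    EquivInvariant (S := S) fun R V _ _ => forestSum c N R V := by
  intro R R' V V' _ _ _ _ e f x y
  dsimp only
  rw [forestSum, forestSum, ← (Equiv.arrowCongr f (e.sumCongr f)).tsum_eq]
  refine tsum_congr fun p => ?_
  simp only [depthLE_congr]
  refine if_congr Iff.rfl ?_ rfl
  rw [forestWeight, forestWeight, ← finprod_comp_equiv (e.sumCongr f)]
  refine finprod_congr fun w => ?_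
  rw [← finWeight_comp_equiv hsymm (f.subtypeEquiv fun v => by
    simp [-Equiv.sumCongr_apply] : {v // p v = w} ≃
      {v // (Equiv.arrowCongr f (e.sumCongr f)) p v = (e.sumCongr f) w})]
  have : Sum.elim (x ∘ e) (y ∘ f) w = Sum.elim x y ((e.sumCongr f) w) := by
    cases w <;> simp
  rw [this]
  rfl

lemma measurable_forestSum [MeasurableSpace S] {c : (k : ℕ) → S → (Fin k → S) → ℝ≥0∞}
    (hmeas : ∀ k : ℕ, Measurable fun p : S × (Fin k → S) => c k p.1 p.2) (N : ℕ)
    (R V : Type) [Finite R] [Finite V] :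
    Measurable fun p : (R → S) × (V → S) => forestSum c N R V p.1 p.2 := by
  refine Measurable.tsum fun p => ?_
  by_cases h : DepthLE N p
  · simp only [h, if_true]
    refine measurable_finprod_ennreal fun w => ?_
    refine (measurable_finWeight hmeas _).comp (Measurable.prodMk ?_
      ((measurable_restrict _).comp measurable_snd))
    cases w
    · exact (measurable_pi_apply _).comp measurable_fst
    · exact (measurable_pi_apply _).comp measurable_snd
  · simp [h]

lemma depthLE_glue {R V : Type} (N : ℕ) {A : Finset V} (g : {v // v ∈ A} → R)
    (q : {v // v ∉ A} → {v // v ∈ A} ⊕ {v // v ∉ A}) :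
    DepthLE (N + 1) (glue A g (Equiv.sumCompl (· ∈ A) ∘ q)) ↔ DepthLE N q := by
  set p := glue A g (Equiv.sumCompl (· ∈ A) ∘ q)
  have hl : ∀ a : {v // v ∈ A}, p a = Sum.inl (g a) := fun a => glue_mem _ _ a
  have hr : ∀ b : {v // v ∉ A}, p b = Sum.inr (Equiv.sumCompl (· ∈ A) (q b)) :=
    fun b => glue_notMem _ _ b
  have key : ∀ k (w : {v // v ∈ A} ⊕ {v // v ∉ A}),
      ((forestStep p)^[k + 1] (Sum.inr (Equiv.sumCompl (· ∈ A) w))).isLeft =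
        ((forestStep q)^[k] w).isLeft := by
    intro k
    induction k with
    | zero =>
      rintro (a | b)
      · simp [forestStep, hl]
      · simp [forestStep, hr]
    | succ k ih =>
      rintro (a | b)
      · rw [Function.iterate_succ_apply, forestStep_iterate_inl]
        simp only [Equiv.sumCompl_apply_inl, forestStep, Sum.elim_inr, hl]
        rw [← forestStep, forestStep_iterate_inl]
        rfl
      · rw [Function.iterate_succ_apply, Function.iterate_succ_apply (forestStep q) k, ← ih]
        simp [forestStep, hr]
  constructor
  · intro h b
    rw [← key]
    exact h _
  · intro h v
    obtain ⟨w, rfl⟩ := (Equiv.sumCompl (· ∈ A)).surjective v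
    rw [key]
    cases w with
    | inl a => rw [forestStep_iterate_inl]; rfl
    | inr b => exact h b

lemma forestWeight_glue {c : (k : ℕ) → S → (Fin k → S) → ℝ≥0∞}
    (hsymm : ∀ (k : ℕ) (x : S) (y : Fin k → S) (σ : Equiv.Perm (Fin k)),
      c k x (y ∘ σ) = c k x y) {R V : Type} [Finite R] [Fintype V] (x : R → S) (y : V → S)
    {A : Finset V} (g : {v // v ∈ A} → R)
    (q : {v // v ∉ A} → {v // v ∈ A} ⊕ {v // v ∉ A}) :
    forestWeight c x y (glue A g (Equiv.sumCompl (· ∈ A) ∘ q)) =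
      (∏ᶠ r, finWeight c {v // g v = r} (x r) fun v => y v) *
        forestWeight c (fun v : {v // v ∈ A} => y v) (fun v : {v // v ∉ A} => y v) q := by
  cases nonempty_fintype R
  rw [forestWeight, finprod_eq_prod_of_fintype, Fintype.prod_sum_type,
    ← finprod_eq_prod_of_fintype, ← finprod_eq_prod_of_fintype, forestWeight,
    ← finprod_comp_equiv (Equiv.sumCompl (· ∈ A))]
  congr 1
  · exact finprod_congr fun r => (finWeight_comp_equiv hsymm (glueFiberLeft g _ r) _ _).symm
  · refine finprod_congr fun w => ?_
    have : Sum.elim x y (Sum.inr (Equiv.sumCompl (· ∈ A) w)) =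
        Sum.elim (fun v : {v // v ∈ A} => y v) (fun v : {v // v ∉ A} => y v) w := by
      cases w <;> simp
    rw [this]
    exact (finWeight_comp_equiv hsymm ((Equiv.subtypeEquivRight fun v => by simp :
      {v // q v = w} ≃ {v // (Equiv.sumCompl (· ∈ A) ∘ q) v = Equiv.sumCompl (· ∈ A) w}).trans
        (glueFiberRight g _ _)) _ _).symm

lemma forestSum_succ {c : (k : ℕ) → S → (Fin k → S) → ℝ≥0∞}
    (hsymm : ∀ (k : ℕ) (x : S) (y : Fin k → S) (σ : Equiv.Perm (Fin k)),
      c k x (y ∘ σ) = c k x y) (N : ℕ) {R V : Type} [Finite R] [Fintype V] (x : R → S)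
    (y : V → S) :
    forestSum c (N + 1) R V x y = ∑ A : Finset V,
      fiberSum (fun r T _ => finWeight c T (x r)) {v // v ∈ A} (fun v => y v) *
        forestSum c N {v // v ∈ A} {v // v ∉ A} (fun v => y v) (fun v => y v) := by
  rw [forestSum, tsum_eq_sum_glue]
  refine Finset.sum_congr rfl fun A _ => ?_
  rw [fiberSum, ← ENNReal.tsum_mul_right]
  refine tsum_congr fun g => ?_
  rw [← (Equiv.arrowCongr (Equiv.refl _) (Equiv.sumCompl (· ∈ A))).tsum_eq, forestSum,
    ← ENNReal.tsum_mul_left]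
  refine tsum_congr fun q => ?_
  change (if DepthLE (N + 1) (glue A g (Equiv.sumCompl (· ∈ A) ∘ q)) then
    forestWeight c x y (glue A g (Equiv.sumCompl (· ∈ A) ∘ q)) else 0) = _
  rw [depthLE_glue, forestWeight_glue hsymm]
  split_ifs <;> simp

lemma forestSum_zero {c : (k : ℕ) → S → (Fin k → S) → ℝ≥0∞}
    (hsymm : ∀ (k : ℕ) (x : S) (y : Fin k → S) (σ : Equiv.Perm (Fin k)),
      c k x (y ∘ σ) = c k x y)
    (hc0 : ∀ (x : S) (y : Fin 0 → S), c 0 x y = 1) {R V : Type} [Finite V] (x : R → S)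
    (y : V → S) : forestSum c 0 R V x y = if IsEmpty V then 1 else 0 := by
  split_ifs with h
  · have hw : ∀ p : V → R ⊕ V, forestWeight c x y p = 1 := by
      intro p
      refine finprod_eq_one_of_forall_eq_one fun w => ?_
      rw [finWeight_eq hsymm (Equiv.equivOfIsEmpty (Fin 0) _), hc0]
    simp [forestSum, DepthLE, hw, tsum_fintype]
  · rw [not_isEmpty_iff] at h
    simp [forestSum, DepthLE]

/-- The iterates of the tree-generating operator, starting from the constant `1`. -/
def treeIter [MeasurableSpace S] (m : Measure S) (c : (k : ℕ) → S → (Fin k → S) → ℝ≥0∞)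
    (N : ℕ) : S → ℝ≥0∞ :=
  (FOp m c)^[N] fun _ => 1

lemma one_add_tsum_lintegral [MeasurableSpace S] (m : Measure S) [SigmaFinite m]
    (f : ∀ n : ℕ, (Fin n → S) → ℝ≥0∞) (hf : ∀ y, f 0 y = 1) :
    1 + ∑' n : ℕ, (1 / ((n + 1).factorial : ℝ≥0∞)) *
        ∫⁻ y : Fin (n + 1) → S, f (n + 1) y ∂(Measure.pi fun _ => m) =
      ∑' n : ℕ, (1 / (n.factorial : ℝ≥0∞)) *
        ∫⁻ y : Fin n → S, f n y ∂(Measure.pi fun _ => m) := by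
  refine Eq.trans ?_ (tsum_eq_zero_add' ENNReal.summable).symm
  congr 1
  simp [hf]

lemma FOp_eq_tsum [MeasurableSpace S] (m : Measure S) [SigmaFinite m]
    {c : (k : ℕ) → S → (Fin k → S) → ℝ≥0∞} (hc0 : ∀ (x : S) (y : Fin 0 → S), c 0 x y = 1)
    (h : S → ℝ≥0∞) (x : S) :
    FOp m c h x = ∑' n : ℕ, (1 / (n.factorial : ℝ≥0∞)) *
      ∫⁻ y : Fin n → S, c n x y * ∏ i, h (y i) ∂(Measure.pi fun _ => m) :=
  one_add_tsum_lintegral m (fun n y => c n x y * ∏ i, h (y i)) fun y => by simp [hc0]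

lemma measurable_FOp [MeasurableSpace S] (m : Measure S) [SigmaFinite m]
    {c : (k : ℕ) → S → (Fin k → S) → ℝ≥0∞}
    (hmeas : ∀ k : ℕ, Measurable fun p : S × (Fin k → S) => c k p.1 p.2)
    {h : S → ℝ≥0∞} (hh : Measurable h) : Measurable (FOp m c h) := by
  unfold FOp
  refine (Measurable.tsum fun n => ?_).const_add 1
  have hp : Measurable fun p : S × (Fin (n + 1) → S) => ∏ i, h (p.2 i) :=
    Finset.measurable_fun_prod _ fun i _ => hh.comp ((measurable_pi_apply _).comp measurable_snd)
  have hc : Measurable fun x => ∫⁻ y : Fin (n + 1) → S, c (n + 1) x y * ∏ i, h (y i)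
      ∂(Measure.pi fun _ => m) :=
    ((hmeas (n + 1)).mul hp).lintegral_prod_right'
  exact hc.const_mul _

lemma tsum_lintegral_forestSum [MeasurableSpace S] (m : Measure S) [SigmaFinite m]
    {c : (k : ℕ) → S → (Fin k → S) → ℝ≥0∞}
    (hmeas : ∀ k : ℕ, Measurable fun p : S × (Fin k → S) => c k p.1 p.2)
    (hsymm : ∀ (k : ℕ) (x : S) (y : Fin k → S) (σ : Equiv.Perm (Fin k)),
      c k x (y ∘ σ) = c k x y)
    (hc0 : ∀ (x : S) (y : Fin 0 → S), c 0 x y = 1) (N : ℕ) :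
    ∀ (R : Type) [Fintype R] (x : R → S),
      ∑' n : ℕ, (1 / (n.factorial : ℝ≥0∞)) *
        ∫⁻ y : Fin n → S, forestSum c N R (Fin n) x y ∂(Measure.pi fun _ => m) =
      ∏ r, treeIter m c N (x r) := by
  induction N with
  | zero =>
    intro R _ x
    simp_rw [forestSum_zero hsymm hc0]
    rw [tsum_eq_single 0]
    · have : IsEmpty (Fin 0) := inferInstance
      simp [treeIter, this]
    · intro n hn
      have : ¬ IsEmpty (Fin n) := by
        rw [not_isEmpty_iff]
        exact ⟨⟨0, Nat.pos_of_ne_zero hn⟩⟩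
      simp [this]
  | succ N ih =>
    intro R _ x
    have hh : Measurable (treeIter m c N) := by
      clear ih
      induction N with
      | zero => exact measurable_const
      | succ N ih =>
        rw [treeIter, Function.iterate_succ_apply']
        exact measurable_FOp m hmeas ih
    have hW : ∀ r (T T' : Type) [Finite T] [Finite T'] (e : T ≃ T') (y : T' → S),
        finWeight c T (x r) (y ∘ e) = finWeight c T' (x r) y :=
      fun r T T' _ _ e y => finWeight_comp_equiv hsymm e _ _
    have hWm : ∀ r (T : Type) [Finite T], Measurable (finWeight c T (x r)) :=
      fun r T _ => (measurable_finWeight hmeas T).comp measurable_prodMk_left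
    simp_rw [forestSum_succ hsymm]
    rw [tsum_lintegral_sum_finset m (fun A B _ _ y z =>
      fiberSum (fun r T _ => finWeight c T (x r)) A y * forestSum c N A B y z)]
    rotate_left
    · intro A A' B B' _ _ _ _ e f y z
      dsimp only
      rw [fiberSum_comp_equiv hW]
      congr 1
      exact forestSum_equivInvariant hsymm N A A' B B' e f y z
    · intro A B _ _
      exact ((measurable_fiberSum hWm _).comp measurable_fst).mul (measurable_forestSum hmeas _ _ _)
    have hF := tsum_lintegral_fiberSum m R
      (fun r T _ z => finWeight c T (x r) z * ∏ᶠ t, treeIter m c N (z t))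
      (fun r T T' _ _ e y => by
        rw [hW, ← finprod_comp_equiv e]
        rfl)
      (fun r T _ => (hWm r T).mul
        (measurable_finprod_ennreal fun t => hh.comp (measurable_pi_apply t)))
    rw [finprod_eq_prod_of_fintype] at hF
    refine Eq.trans ?_ (hF.trans ?_)
    · refine tsum_congr fun a => ?_
      congr 1
      refine lintegral_congr fun y => ?_
      have hm : ∀ b, Measurable fun z : Fin b → S => forestSum c N (Fin a) (Fin b) y z :=
        fun b => (measurable_forestSum hmeas N _ _).comp measurable_prodMk_left
      simp_rw [lintegral_const_mul _ (hm _), mul_left_comm (1 / _ : ℝ≥0∞)]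
      rw [ENNReal.tsum_mul_left, ih, fiberSum, fiberSum, ← ENNReal.tsum_mul_right]
      refine tsum_congr fun g => ?_
      simp_rw [finprod_eq_prod_of_fintype]
      rw [Finset.prod_mul_distrib]
      congr 1
      exact (Fintype.prod_fiberwise g fun i => treeIter m c N (y i)).symm
    · refine Finset.prod_congr rfl fun r _ => ?_
      have : treeIter m c (N + 1) = FOp m c (treeIter m c N) := Function.iterate_succ_apply' _ _ _
      rw [this, FOp_eq_tsum m hc0]
      refine tsum_congr fun n => ?_
      congr 1
      refine lintegral_congr fun y => ?_
      rw [finprod_eq_prod_of_fintype, finWeight_eq hsymm (Equiv.refl _)]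
      rfl

section ParentGraph

variable {W : Type} {q : W → W} {r : W}

/-- The graph joining every vertex to its parent. -/
def parentGraph (q : W → W) : SimpleGraph W := SimpleGraph.fromRel fun u v => q u = v

/-- The number of steps along the parent map needed to reach `r`. -/
def parentHeight (q : W → W) (r v : W) : ℕ := sInf {k | q^[k] v = r}

lemma parentHeight_self : parentHeight q r r = 0 :=
  Nat.sInf_eq_zero.mpr (Or.inl rfl)

lemma parentHeight_le_iff (hr : q r = r) (hq : ∀ v, ∃ k, q^[k] v = r) (v : W) (N : ℕ) :
    parentHeight q r v ≤ N ↔ q^[N] v = r := by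
  refine ⟨fun h => ?_, fun h => Nat.sInf_le h⟩
  obtain ⟨d, rfl⟩ := Nat.exists_eq_add_of_le' h
  have : q^[parentHeight q r v] v = r := Nat.sInf_mem (hq v)
  rw [Function.iterate_add_apply, this, Function.iterate_fixed hr]

lemma parentHeight_of_ne (hr : q r = r) (hq : ∀ v, ∃ k, q^[k] v = r) {v : W} (hv : v ≠ r) :
    parentHeight q r v = parentHeight q r (q v) + 1 := by
  apply le_antisymm
  · rw [parentHeight_le_iff hr hq, Function.iterate_succ_apply, ← parentHeight_le_iff hr hq]
  · have h := (parentHeight_le_iff hr hq v _).mp le_rfl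
    cases hk : parentHeight q r v with
    | zero =>
      rw [hk] at h
      exact absurd h hv
    | succ k =>
      rw [hk, Function.iterate_succ_apply, ← parentHeight_le_iff hr hq] at h
      exact Nat.succ_le_succ h

lemma parentGraph_adj {u v : W} : (parentGraph q).Adj u v ↔ u ≠ v ∧ (q u = v ∨ q v = u) :=
  SimpleGraph.fromRel_adj _ _ _

lemma parentGraph_adj_parent (hr : q r = r) (hq : ∀ v, ∃ k, q^[k] v = r) {v : W} (hv : v ≠ r) :
    (parentGraph q).Adj v (q v) := by
  refine parentGraph_adj.mpr ⟨fun h => ?_, Or.inl rfl⟩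
  have := parentHeight_of_ne hr hq hv
  rw [← h] at this
  omega

lemma exists_walk_length_eq_parentHeight (hr : q r = r) (hq : ∀ v, ∃ k, q^[k] v = r) (v : W) :
    ∃ w : (parentGraph q).Walk v r, w.length = parentHeight q r v := by
  induction hn : parentHeight q r v generalizing v with
  | zero =>
    obtain rfl : v = r := (parentHeight_le_iff hr hq v 0).mp hn.le
    exact ⟨SimpleGraph.Walk.nil, rfl⟩
  | succ n ih =>
    have hv : v ≠ r := by
      rintro rfl
      simp [parentHeight_self] at hn
    have h := parentHeight_of_ne hr hq hv
    obtain ⟨w, hw⟩ := ih (q v) (by omega)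
    exact ⟨SimpleGraph.Walk.cons (parentGraph_adj_parent hr hq hv) w, by simp [hw]⟩

lemma parentGraph_connected (hr : q r = r) (hq : ∀ v, ∃ k, q^[k] v = r) :
    (parentGraph q).Connected := by
  have h : ∀ v, (parentGraph q).Reachable v r := fun v =>
    ⟨(exists_walk_length_eq_parentHeight hr hq v).choose⟩
  have : Nonempty W := ⟨r⟩
  exact ⟨fun u v => (h u).trans (h v).symm⟩

lemma parentHeight_le_add_length (hr : q r = r) (hq : ∀ v, ∃ k, q^[k] v = r) {u v : W}
    (w : (parentGraph q).Walk u v) : parentHeight q r u ≤ parentHeight q r v + w.length := by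
  induction w with
  | nil => simp
  | @cons a b _ h w ih =>
    have hab : parentHeight q r a ≤ parentHeight q r b + 1 := by
      by_cases ha : a = r
      · rw [ha, parentHeight_self]; omega
      obtain ⟨-, h | h⟩ := parentGraph_adj.mp h
      · rw [parentHeight_of_ne hr hq ha, h]
      · by_cases hb : b = r
        · exact absurd (by rw [← h, hb, hr]) ha
        · rw [parentHeight_of_ne hr hq hb, h]; omega
    simp only [SimpleGraph.Walk.length_cons]
    omega

lemma parentGraph_dist (hr : q r = r) (hq : ∀ v, ∃ k, q^[k] v = r) (v : W) :
    (parentGraph q).dist r v = parentHeight q r v := by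
  rw [SimpleGraph.dist_comm]
  apply le_antisymm
  · obtain ⟨w, hw⟩ := exists_walk_length_eq_parentHeight hr hq v
    exact hw ▸ SimpleGraph.dist_le w
  · obtain ⟨w, hw⟩ := (parentGraph_connected hr hq).exists_walk_length_eq_dist v r
    have := parentHeight_le_add_length hr hq w
    rw [parentHeight_self] at this
    omega

lemma parentGraph_isTree [Finite W] (hr : q r = r) (hq : ∀ v, ∃ k, q^[k] v = r) :
    (parentGraph q).IsTree := by
  have hc := parentGraph_connected hr hq
  refine SimpleGraph.isTree_iff_connected_and_card.mpr
    ⟨hc, le_antisymm ?_ hc.card_vert_le_card_edgeSet_add_one⟩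
  cases nonempty_fintype W
  have hsub : (parentGraph q).edgeSet ⊆
      (((Finset.univ.erase r).image fun v => s(v, q v) : Finset (Sym2 W)) : Set (Sym2 W)) := by
    intro e
    induction e with
    | _ u v =>
      intro he
      obtain ⟨hne, h⟩ := parentGraph_adj.mp he
      simp only [Finset.coe_image, Set.mem_image, Finset.mem_coe, Finset.mem_erase,
        Finset.mem_univ, and_true]
      rcases h with h | h
      · refine ⟨u, ?_, by rw [h]⟩
        rintro rfl
        exact hne (hr.symm.trans h)
      · refine ⟨v, ?_, by rw [h, Sym2.eq_swap]⟩
        rintro rfl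
        exact hne (h.symm.trans hr)
  have h1 := Nat.card_mono (Finset.finite_toSet _) hsub
  have h2 := Finset.card_image_le (s := Finset.univ.erase r) (f := fun v => s(v, q v))
  rw [Finset.card_erase_of_mem (Finset.mem_univ r), Finset.card_univ] at h2
  have h3 : 0 < Fintype.card W := Fintype.card_pos_iff.mpr ⟨r⟩
  rw [Nat.card_coe_set_eq (SetLike.coe (Finset.image _ _)), Set.ncard_coe_finset] at h1
  rw [Nat.card_eq_fintype_card (α := W)]
  omega

lemma parentGraph_child_iff (hr : q r = r) (hq : ∀ v, ∃ k, q^[k] v = r) {i j : W} :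
    ((parentGraph q).Adj i j ∧ (parentGraph q).dist r j = (parentGraph q).dist r i + 1) ↔
      j ≠ r ∧ q j = i := by
  rw [parentGraph_dist hr hq, parentGraph_dist hr hq]
  constructor
  · rintro ⟨hadj, hd⟩
    have hj : j ≠ r := by
      rintro rfl
      rw [parentHeight_self] at hd
      omega
    refine ⟨hj, ?_⟩
    obtain ⟨hne, h | h⟩ := parentGraph_adj.mp hadj
    · by_cases hi : i = r
      · exact absurd (by rw [← h, hi, hr]) hj
      · have := parentHeight_of_ne hr hq hi
        rw [h] at this
        omega
    · exact h
  · rintro ⟨hj, rfl⟩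
    exact ⟨(parentGraph_adj_parent hr hq hj).symm, parentHeight_of_ne hr hq hj⟩

lemma parentGraph_injective {q' : W → W} (hr : q r = r) (hq : ∀ v, ∃ k, q^[k] v = r)
    (hr' : q' r = r) (hq' : ∀ v, ∃ k, q'^[k] v = r) (h : parentGraph q = parentGraph q') :
    q = q' := by
  funext v
  by_cases hv : v = r
  · rw [hv, hr, hr']
  · have := (parentGraph_child_iff hr hq).mpr ⟨hv, rfl⟩
    rw [h] at this
    exact ((parentGraph_child_iff hr' hq').mp this).2.symm

/-- Every tree is the graph of a parent map towards a given root. -/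
lemma SimpleGraph.IsTree.exists_parentGraph_eq {τ : SimpleGraph W} (hτ : τ.IsTree) (r : W) :
    ∃ q : W → W, q r = r ∧ (∀ v, ∃ k, q^[k] v = r) ∧ parentGraph q = τ := by
  have hex : ∀ v, ∃ u, (v = r → u = r) ∧ (v ≠ r → τ.Adj v u ∧ τ.dist u r + 1 = τ.dist v r) := by
    intro v
    by_cases hv : v = r
    · exact ⟨r, fun _ => rfl, fun h => absurd hv h⟩
    obtain ⟨w, hw⟩ := hτ.connected.exists_walk_length_eq_dist v r
    cases w with
    | nil => exact absurd rfl hv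
    | @cons _ u _ h w =>
      refine ⟨u, fun h => absurd h hv, fun _ => ⟨h, ?_⟩⟩
      have h1 := SimpleGraph.dist_le w
      have h2 := hτ.connected.dist_triangle (u := v) (v := u) (w := r)
      rw [SimpleGraph.dist_eq_one_iff_adj.mpr h] at h2
      rw [SimpleGraph.Walk.length_cons] at hw
      omega
  choose q hqr hq using hex
  have hr : q r = r := hqr r rfl
  have hreach : ∀ v, ∃ k, q^[k] v = r := by
    intro v
    induction hn : τ.dist v r generalizing v with
    | zero => exact ⟨0, hτ.connected.dist_eq_zero_iff.mp hn⟩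
    | succ n ih =>
      have hv : v ≠ r := by
        rintro rfl
        simp at hn
      obtain ⟨k, hk⟩ := ih (q v) (by have := (hq v hv).2; omega)
      exact ⟨k + 1, hk⟩
  refine ⟨q, hr, hreach, ?_⟩
  have hle : parentGraph q ≤ τ := by
    intro u v huv
    obtain ⟨hne, h | h⟩ := parentGraph_adj.mp huv
    · have hu : u ≠ r := by
        rintro rfl
        exact hne (hr.symm.trans h)
      exact h ▸ (hq u hu).1
    · have hv : v ≠ r := by
        rintro rfl
        exact hne (h.symm.trans hr)
      exact h ▸ (hq v hv).1.symm
  exact le_antisymm hle ((SimpleGraph.isTree_iff_minimal_connected.mp hτ).2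
    (parentGraph_connected hr hreach) hle)

end ParentGraph

/-- The vertex `0` as the only root and the other vertices of `{0,…,n}`. -/
def unitSumFinEquiv (n : ℕ) : Unit ⊕ Fin n ≃ Fin (n + 1) where
  toFun := Sum.elim (fun _ => 0) Fin.succ
  invFun := Fin.cases (Sum.inl ()) Sum.inr
  left_inv := by rintro (_ | i) <;> rfl
  right_inv i := by cases i using Fin.cases <;> rfl

/-- The parent map on `{0,…,n}` of a forest with one root. -/
def rootedParent {n : ℕ} (p : Fin n → Unit ⊕ Fin n) : Fin (n + 1) → Fin (n + 1) :=
  (unitSumFinEquiv n).conj (forestStep p)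

lemma rootedParent_zero {n : ℕ} (p : Fin n → Unit ⊕ Fin n) : rootedParent p 0 = 0 := rfl

lemma rootedParent_succ {n : ℕ} (p : Fin n → Unit ⊕ Fin n) (v : Fin n) :
    rootedParent p v.succ = unitSumFinEquiv n (p v) := rfl

lemma depthLE_iff_rootedParent {n : ℕ} (N : ℕ) (p : Fin n → Unit ⊕ Fin n) :
    DepthLE N p ↔ ∀ i, (rootedParent p)^[N] i = 0 := by
  have h : Function.Semiconj (unitSumFinEquiv n) (forestStep p) (rootedParent p) :=
    fun w => by simp [rootedParent, Equiv.conj_apply]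
  have h0 : ∀ w, unitSumFinEquiv n w = 0 ↔ w.isLeft := by
    rintro (_ | v)
    · exact iff_of_true rfl rfl
    · exact iff_of_false (Fin.succ_ne_zero v) (by simp)
  have hs : ∀ v : Fin n, (rootedParent p)^[N] v.succ = 0 ↔
      ((forestStep p)^[N] (Sum.inr v)).isLeft := by
    intro v
    rw [← h0, (h.iterate_right N) (Sum.inr v)]
    rfl
  rw [Fin.forall_fin_succ, DepthLE]
  simp_rw [hs]
  exact ⟨fun h => ⟨Function.iterate_fixed (rootedParent_zero p) N, h⟩, fun h => h.2⟩

lemma treeCN_eq_forestSum {c : (k : ℕ) → S → (Fin k → S) → ℝ≥0∞}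
    (hsymm : ∀ (k : ℕ) (x : S) (y : Fin k → S) (σ : Equiv.Perm (Fin k)),
      c k x (y ∘ σ) = c k x y) (n N : ℕ) (x : S) (y : Fin n → S) :
    treeCN c n N (Fin.cons x y) = forestSum c N Unit (Fin n) (fun _ => x) y := by
  rw [treeCN, forestSum, tsum_fintype, ← Finset.sum_filter, ← Finset.sum_filter]
  have hreach : ∀ {p : Fin n → Unit ⊕ Fin n}, DepthLE N p → ∀ i, ∃ k, (rootedParent p)^[k] i = 0 :=
    fun hp i => ⟨N, (depthLE_iff_rootedParent N _).mp hp i⟩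
  symm
  refine Finset.sum_nbij (fun p => parentGraph (rootedParent p)) ?_ ?_ ?_ ?_
  · intro p hp
    have hp := (Finset.mem_filter.mp hp).2
    have h0 := rootedParent_zero p
    refine Finset.mem_filter.mpr ⟨Finset.mem_univ _, parentGraph_isTree h0 (hreach hp), fun i => ?_⟩
    rw [parentGraph_dist h0 (hreach hp), parentHeight_le_iff h0 (hreach hp)]
    exact (depthLE_iff_rootedParent N p).mp hp i
  · intro p hp p' hp' h
    have hp := (Finset.mem_filter.mp hp).2
    have hp' := (Finset.mem_filter.mp hp').2
    have hq := parentGraph_injective (rootedParent_zero p) (hreach hp) (rootedParent_zero p')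
      (hreach hp') h
    funext v
    exact (unitSumFinEquiv n).injective (congrFun hq v.succ)
  · intro τ hτ
    obtain ⟨-, hτ, hd⟩ := Finset.mem_filter.mp (Finset.mem_coe.mp hτ)
    obtain ⟨q, h0, hq, rfl⟩ := hτ.exists_parentGraph_eq 0
    have hpq : rootedParent (fun v => (unitSumFinEquiv n).symm (q v.succ)) = q := by
      funext i
      cases i using Fin.cases with
      | zero => exact h0.symm
      | succ v => rw [rootedParent_succ, Equiv.apply_symm_apply]
    refine ⟨fun v => (unitSumFinEquiv n).symm (q v.succ), ?_, congrArg parentGraph hpq⟩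
    refine Finset.mem_coe.mpr (Finset.mem_filter.mpr ⟨Finset.mem_univ _, ?_⟩)
    rw [depthLE_iff_rootedParent, hpq]
    intro i
    rw [← parentHeight_le_iff h0 hq, ← parentGraph_dist h0 hq]
    exact hd i
  · intro p hp
    have hp := (Finset.mem_filter.mp hp).2
    rw [forestWeight, finprod_eq_prod_of_fintype]
    refine Fintype.prod_equiv (unitSumFinEquiv n) _ _ fun w => ?_
    have hmem : ∀ j, j ∈ childrenF (parentGraph (rootedParent p)) (unitSumFinEquiv n w) ↔
        j ≠ 0 ∧ rootedParent p j = unitSumFinEquiv n w := fun j => by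
      rw [childrenF, Finset.mem_filter, parentGraph_child_iff (rootedParent_zero p) (hreach hp)]
      simp
    have hx : Sum.elim (fun _ => x) y w = (Fin.cons x y : Fin (n + 1) → S) (unitSumFinEquiv n w) := by
      cases w <;> rfl
    let e : {v // p v = w} ≃
        {j // j ∈ childrenF (parentGraph (rootedParent p)) (unitSumFinEquiv n w)} :=
      Equiv.ofBijective (fun v => ⟨v.1.succ, (hmem _).mpr ⟨Fin.succ_ne_zero _, by
        rw [rootedParent_succ, v.2]⟩⟩) ⟨fun v v' h => by
          simpa [Subtype.ext_iff] using h, by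
          rintro ⟨j, hj⟩
          obtain ⟨hj0, hj⟩ := (hmem j).mp hj
          obtain ⟨v, rfl⟩ := Fin.exists_succ_eq.mpr hj0
          exact ⟨⟨v, (unitSumFinEquiv n).injective hj⟩, rfl⟩⟩
    rw [← hx]
    refine Eq.trans ?_ (finWeight_eq hsymm ((childrenF (parentGraph (rootedParent p))
      (unitSumFinEquiv n w)).orderIsoOfFin rfl).toEquiv _
        fun j => (Fin.cons x y : Fin (n + 1) → S) j)
    rw [← finWeight_comp_equiv hsymm e]
    rfl

end RootedForests

/-- iterative generation of trees, `𝓕(0) = 1` and `𝓕(𝓒^N) = 𝓒^{N+1}`. -/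
theorem statement11 {S : Type*} [MeasurableSpace S] (m : Measure S) [SigmaFinite m]
    (c : (k : ℕ) → S → (Fin k → S) → ℝ≥0∞)
    (hmeas : ∀ k : ℕ, Measurable fun p : S × (Fin k → S) => c k p.1 p.2)
    (hsymm : ∀ (k : ℕ) (x : S) (y : Fin k → S) (σ : Equiv.Perm (Fin k)),
      c k x (y ∘ σ) = c k x y)
    (hc0 : ∀ (x : S) (y : Fin 0 → S), c 0 x y = 1) :
    FOp m c (fun _ => 0) = (fun _ => 1) ∧
    CInt m c 0 = (fun _ => 1) ∧
    ∀ N : ℕ, FOp m c (CInt m c N) = CInt m c (N + 1) := by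
  have hCInt : ∀ N, CInt m c N = treeIter m c N := by
    intro N
    funext x
    have h := tsum_lintegral_forestSum m hmeas hsymm hc0 N Unit fun _ => x
    rw [← one_add_tsum_lintegral m
      (fun n y => forestSum c N Unit (Fin n) (fun _ => x) y)] at h
    · simpa only [CInt, treeCN_eq_forestSum hsymm, Fintype.prod_unique] using h
    · intro y
      have hw : ∀ p : Fin 0 → Unit ⊕ Fin 0, forestWeight c (fun _ => x) y p = 1 := fun p =>
        finprod_eq_one_of_forall_eq_one fun w => by
          rw [finWeight_eq hsymm (Equiv.equivOfIsEmpty (Fin 0) _), hc0]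
      simp [forestSum, DepthLE, hw, tsum_fintype]
  refine ⟨?_, hCInt 0, fun N => ?_⟩
  · funext x
    simp [FOp]
  · rw [hCInt, hCInt]
    exact (Function.iterate_succ_apply' _ _ _).symm
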